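/- arXiv:0908.3111 — 2 statements merged into one kernel-verified Lean document; each statement's English description precedes it below -/
import Mathlib

section
/- Let G be a finite simple graph with an edge e. Then the map Θ_e is surjective onto tubings of G − e: for every tubing T of G − e there exists a tubing T′ of G with Θ_e(T′) = T. -/
/-- A tube of a graph `G`: a nonempty set of vertices whose induced subgraph is connected. -/
def IsTube {V : Type*} (G : SimpleGraph V) (t : Set V) : Prop :=
  t.Nonempty ∧ (G.induce t).Connected

/-- Two tubes are compatible if they are nested or their union is not a tube (far apart). -/
def TubeCompatible {V : Type*} (G : SimpleGraph V) (t u : Set V) : Prop :=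
  t ⊆ u ∨ u ⊆ t ∨ ¬ IsTube G (t ∪ u)

/-- A tubing of `G`: a set of pairwise compatible proper tubes which, when `G` is
disconnected, does not contain every connected-component vertex set of `G`. -/
def IsTubing {V : Type*} (G : SimpleGraph V) (T : Set (Set V)) : Prop :=
  (∀ t ∈ T, IsTube G t ∧ t ≠ Set.univ) ∧
  (∀ t ∈ T, ∀ u ∈ T, TubeCompatible G t u) ∧
  (¬ G.Preconnected → ¬ ∀ c : G.ConnectedComponent, c.supp ∈ T)

/-- The vertex set of the connected component, within the induced subgraph of `H` on `t`,
containing the vertex `v` of `t`. -/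
def compSet {V : Type*} (H : SimpleGraph V) (t : Set V) (v : t) : Set V :=
  Subtype.val '' {w : t | (H.induce t).Reachable v w}

/-- The projection sending a collection `T` of subsets of vertices to the collection of all
vertex sets of connected components (in the graph `H`) of members of `T`. -/
def Theta {V : Type*} (H : SimpleGraph V) (T : Set (Set V)) : Set (Set V) :=
  {c | ∃ t ∈ T, ∃ v : t, c = compSet H t v}

section Tubes

variable {V : Type*} {G H : SimpleGraph V}

/-- `compSet H t v` contains its base point. -/
theorem mem_compSet_self (t : Set V) (v : t) : (v : V) ∈ compSet H t v :=
  ⟨v, SimpleGraph.Reachable.refl _, rfl⟩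

theorem compSet_closed {t : Set V} {v : t} {x y : V} (hx : x ∈ compSet H t v) (hy : y ∈ t)
    (hxy : H.Adj x y) : y ∈ compSet H t v := by
  obtain ⟨w, hw, rfl⟩ := hx
  have hadj : (H.induce t).Adj w ⟨y, hy⟩ := hxy
  exact ⟨⟨y, hy⟩, SimpleGraph.Reachable.trans hw hadj.reachable, rfl⟩

/-- A set that contains `v` and is closed under adjacency within `t` contains the component
of `v` in `t`. -/
theorem compSet_subset_of_closed {t s : Set V} {v : t} (hv : (v : V) ∈ s)
    (hs : ∀ x ∈ s, ∀ y ∈ t, H.Adj x y → y ∈ s) : compSet H t v ⊆ s := by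
  rintro _ ⟨w, hw, rfl⟩
  have hw' : Relation.ReflTransGen (H.induce t).Adj v w :=
    (SimpleGraph.reachable_iff_reflTransGen _ _).1 hw
  induction hw' with
  | refl => exact hv
  | tail h hadj ih =>
    exact hs _ (ih ((SimpleGraph.reachable_iff_reflTransGen _ _).2 h)) _ (Subtype.prop _) hadj

theorem isTube_of_closed {t : Set V} (hne : t.Nonempty)
    (h : ∀ s : Set V, (s ∩ t).Nonempty → (∀ x ∈ s, ∀ y ∈ t, H.Adj x y → y ∈ s) → t ⊆ s) :
    IsTube H t := by
  refine ⟨hne, (SimpleGraph.connected_iff _).2 ⟨fun v w => ?_, hne.to_subtype⟩⟩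
  obtain ⟨w', hw', hw⟩ := h (compSet H t v) ⟨v, mem_compSet_self t v, v.2⟩
    (fun x hx y hy => compSet_closed hx hy) w.2
  rwa [← Subtype.ext hw]

theorem IsTube.subset_of_closed {t s : Set V} (ht : IsTube H t) (hne : (s ∩ t).Nonempty)
    (hs : ∀ x ∈ s, ∀ y ∈ t, H.Adj x y → y ∈ s) : t ⊆ s := by
  obtain ⟨v, hvs, hvt⟩ := hne
  intro w hw
  exact compSet_subset_of_closed (v := ⟨v, hvt⟩) hvs hs
    ⟨⟨w, hw⟩, ht.2.preconnected ⟨v, hvt⟩ ⟨w, hw⟩, rfl⟩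

theorem IsTube.mono {t : Set V} (hle : H ≤ G) (ht : IsTube H t) : IsTube G t :=
  isTube_of_closed ht.1 fun _ hne hs =>
    ht.subset_of_closed hne fun x hx y hy hxy => hs x hx y hy (hle hxy)

theorem IsTube.union {t u : Set V} (ht : IsTube H t) (hu : IsTube H u) {x y : V} (hx : x ∈ t)
    (hy : y ∈ u) (hxy : x = y ∨ H.Adj x y) : IsTube H (t ∪ u) := by
  refine isTube_of_closed (ht.1.mono Set.subset_union_left) fun s hne hs => ?_
  have hst : (s ∩ t).Nonempty → t ⊆ s := fun h =>
    ht.subset_of_closed h fun x hx y hy => hs x hx y (Or.inl hy)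
  have hsu : (s ∩ u).Nonempty → u ⊆ s := fun h =>
    hu.subset_of_closed h fun x hx y hy => hs x hx y (Or.inr hy)
  obtain ⟨z, hzs, hz | hz⟩ := hne
  · have hts := hst ⟨z, hzs, hz⟩
    refine Set.union_subset hts (hsu ⟨y, ?_, hy⟩)
    rcases hxy with rfl | hxy
    · exact hts hx
    · exact hs x (hts hx) y (Or.inr hy) hxy
  · have hus := hsu ⟨z, hzs, hz⟩
    refine Set.union_subset (hst ⟨x, ?_, hx⟩) hus
    rcases hxy with rfl | hxy
    · exact hus hy
    · exact hs y (hus hy) x (Or.inl hx) hxy.symm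

theorem not_isTube_union {t u : Set V} (ht : t.Nonempty) (hu : u.Nonempty)
    (hd : ∀ x ∈ t, x ∉ u) (hadj : ∀ x ∈ t, ∀ y ∈ u, ¬ G.Adj x y) : ¬ IsTube G (t ∪ u) := by
  intro h
  obtain ⟨x, hx⟩ := ht
  obtain ⟨y, hy⟩ := hu
  refine hd y (h.subset_of_closed (s := t) ⟨x, hx, Or.inl hx⟩ ?_ (Or.inr hy)) hy
  rintro x hx y (hy | hy) hxy
  · exact hy
  · exact absurd hxy (hadj x hx y hy)

theorem TubeCompatible.symm {t u : Set V} (h : TubeCompatible G t u) : TubeCompatible G u t := by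
  rcases h with h | h | h
  · exact Or.inr (Or.inl h)
  · exact Or.inl h
  · exact Or.inr (Or.inr (by rwa [Set.union_comm]))

/-- Compatible tubes are nested, or disjoint and nonadjacent. -/
theorem TubeCompatible.nested_or_apart {t u : Set V} (h : TubeCompatible H t u) (ht : IsTube H t)
    (hu : IsTube H u) :
    t ⊆ u ∨ u ⊆ t ∨ (∀ x ∈ t, x ∉ u) ∧ ∀ x ∈ t, ∀ y ∈ u, ¬ H.Adj x y :=
  h.imp_right <| Or.imp_right fun h =>
    ⟨fun _ hxt hxu => h (ht.union hu hxt hxu (Or.inl rfl)),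
      fun _ hx _ hy hxy => h (ht.union hu hx hy (Or.inr hxy))⟩

theorem compSet_eq {s c : Set V} {v : s} (hc : IsTube H c) (hcs : c ⊆ s) (hv : (v : V) ∈ c)
    (hcl : ∀ x ∈ c, ∀ y ∈ s, H.Adj x y → y ∈ c) : compSet H s v = c :=
  (compSet_subset_of_closed hv hcl).antisymm <|
    hc.subset_of_closed ⟨v, mem_compSet_self s v, hv⟩ fun _ hx _ hy hxy =>
      compSet_closed hx (hcs hy) hxy

theorem isTube_supp (c : H.ConnectedComponent) : IsTube H c.supp :=
  ⟨c.nonempty_supp, c.connected_toSimpleGraph⟩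

theorem compSet_eq_supp {s : Set V} {c : H.ConnectedComponent} {v : s} (hcs : c.supp ⊆ s)
    (hv : (v : V) ∈ c.supp) : compSet H s v = c.supp :=
  compSet_eq (isTube_supp c) hcs hv fun _ hx _ _ hxy => c.mem_supp_of_adj_mem_supp hx hxy

/-- A tubing does not contain all the connected components, even if the graph is connected. -/
theorem IsTubing.exists_supp_notMem [Nonempty V] {T : Set (Set V)} (hT : IsTubing H T) :
    ∃ c : H.ConnectedComponent, c.supp ∉ T := by
  by_contra! hall
  by_cases hp : H.Preconnected
  · have v : V := Classical.arbitrary V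
    exact (hT.1 _ (hall (H.connectedComponentMk v))).2
      (Set.eq_univ_of_forall fun w => SimpleGraph.ConnectedComponent.sound (hp w v))
  · exact hT.2.2 hp hall

/-- A set of pairwise compatible tubes of `G` that projects to a tubing of a subgraph is
a tubing. -/
theorem isTubing_of_theta [Nonempty V] {T T' : Set (Set V)} (hle : H ≤ G) (hT : IsTubing H T)
    (htube : ∀ t ∈ T', IsTube G t) (hcompat : ∀ t ∈ T', ∀ u ∈ T', TubeCompatible G t u)
    (hTheta : Theta H T' = T) : IsTubing G T' := by
  obtain ⟨c, hc⟩ := hT.exists_supp_notMem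
  obtain ⟨v, hv⟩ := c.nonempty_supp
  have key : ∀ s ∈ T', ¬ c.supp ⊆ s := fun s hs hcs =>
    hc (hTheta ▸ ⟨s, hs, ⟨v, hcs hv⟩, (compSet_eq_supp hcs hv).symm⟩)
  refine ⟨fun t ht => ⟨htube t ht, ?_⟩, hcompat, fun _ hall => ?_⟩
  · rintro rfl
    exact key _ ht (Set.subset_univ _)
  · refine key _ (hall (G.connectedComponentMk v)) fun w hw => ?_
    exact SimpleGraph.ConnectedComponent.sound
      ((SimpleGraph.ConnectedComponent.exact (hw.trans hv.symm)).mono hle)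

/-- Enlarge by `A` the sets that contain `b` but not `a`. -/
def enlarge (a b : V) (A t : Set V) : Set V :=
  {x | x ∈ t ∨ b ∈ t ∧ a ∉ t ∧ x ∈ A}

theorem enlarge_of_mem {a b : V} {A t : Set V} (h : b ∈ t ∧ a ∉ t) :
    enlarge a b A t = A ∪ t := by
  ext x; simp [enlarge, h, or_comm]

theorem enlarge_of_not {a b : V} {A t : Set V} (h : ¬ (b ∈ t ∧ a ∉ t)) :
    enlarge a b A t = t := by
  ext x; simp only [enlarge, Set.mem_ofPred_eq]; tauto

end Tubes

/-- The projection `Θ_e` is surjective onto tubings of `G − e`. -/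
theorem theta_surjective {V : Type*} [Fintype V] (G : SimpleGraph V)
    (e : Sym2 V) (he : e ∈ G.edgeSet) (T : Set (Set V))
    (hT : IsTubing (G.deleteEdges {e}) T) :
    ∃ T' : Set (Set V), IsTubing G T' ∧ Theta (G.deleteEdges {e}) T' = T := by
  induction e with | _ a b
  have hab : G.Adj a b := he
  have hadj : ∀ x y, G.Adj x y → ¬ (G.deleteEdges {s(a, b)}).Adj x y →
      x = a ∧ y = b ∨ x = b ∧ y = a := by
    intro x y hxy hn
    simpa [SimpleGraph.deleteEdges_adj, hxy, Sym2.eq_iff, -not_or, -not_and] using hn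
  have hle : G.deleteEdges {s(a, b)} ≤ G := SimpleGraph.deleteEdges_le _
  generalize G.deleteEdges {s(a, b)} = H at *
  have htube : ∀ t ∈ T, IsTube H t := fun t ht => (hT.1 t ht).1
  have hnest : ∀ t ∈ T, ∀ u ∈ T,
      t ⊆ u ∨ u ⊆ t ∨ (∀ x ∈ t, x ∉ u) ∧ ∀ x ∈ t, ∀ y ∈ u, ¬ H.Adj x y :=
    fun t ht u hu => (hT.2.1 t ht u hu).nested_or_apart (htube t ht) (htube u hu)
  obtain ⟨A, hA, hmax⟩ : ∃ A : Set V, (A = ∅ ∨ A ∈ T ∧ a ∈ A ∧ b ∉ A) ∧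
      ∀ t ∈ T, a ∈ t → b ∉ t → t ⊆ A := by
    rcases Set.eq_empty_or_nonempty {t | t ∈ T ∧ a ∈ t ∧ b ∉ t} with h0 | hne
    · refine ⟨∅, Or.inl rfl, fun t ht hat hbt => ?_⟩
      exact absurd (show t ∈ {t | t ∈ T ∧ a ∈ t ∧ b ∉ t} from ⟨ht, hat, hbt⟩) (h0 ▸ id)
    · obtain ⟨A, hA⟩ := (Set.toFinite _).exists_maximal hne
      refine ⟨A, Or.inr hA.prop, fun t ht hat hbt => ?_⟩
      rcases hnest t ht A hA.prop.1 with h | h | h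
      · exact h
      · exact hA.le_of_ge ⟨ht, hat, hbt⟩ h
      · exact absurd hA.prop.2.1 (h.1 a hat)
  -- `A` is apart from every tube that contains `b` but not `a`.
  have hapart : ∀ t ∈ T, b ∈ t → a ∉ t →
      (∀ x ∈ A, x ∉ t) ∧ ∀ x ∈ A, ∀ y ∈ t, ¬ H.Adj x y := by
    intro t ht hbt hat
    rcases hA with rfl | ⟨hAT, haA, hbA⟩
    · simp
    · rcases hnest A hAT t ht with h | h | h
      · exact absurd (h haA) hat
      · exact absurd (h hbt) hbA
      · exact h
  have hcomp : ∀ t ∈ T, ∀ v : enlarge a b A t, (v : V) ∈ t →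
      compSet H (enlarge a b A t) v = t := by
    intro t ht v hv
    refine compSet_eq (htube t ht) (fun x hx => Or.inl hx) hv ?_
    rintro x hx y (hy | ⟨hbt, hat, hy⟩) hxy
    · exact hy
    · exact absurd hxy.symm ((hapart t ht hbt hat).2 y hy x hx)
  have hTheta : Theta H (enlarge a b A '' T) = T := by
    ext c
    constructor
    · rintro ⟨_, ⟨t, ht, rfl⟩, v, rfl⟩
      rcases v.2 with hv | ⟨hbt, hat, hv⟩
      · rwa [hcomp t ht v hv]
      · have hAT : A ∈ T := by
          rcases hA with rfl | h
          · exact absurd hv (Set.notMem_empty _)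
          · exact h.1
        rw [compSet_eq (s := enlarge a b A t) (htube A hAT) (fun x hx => Or.inr ⟨hbt, hat, hx⟩) hv]
        · exact hAT
        · rintro x hx y (hy | ⟨-, -, hy⟩) hxy
          · exact absurd hxy ((hapart t ht hbt hat).2 x hx y hy)
          · exact hy
    · intro hc
      obtain ⟨v, hv⟩ := (htube c hc).1
      exact ⟨_, ⟨c, hc, rfl⟩, ⟨v, Or.inl hv⟩, (hcomp c hc ⟨v, Or.inl hv⟩ hv).symm⟩
  have : Nonempty V := ⟨a⟩
  have hmixed : ∀ t ∈ T, ∀ u ∈ T, b ∈ t ∧ a ∉ t → ¬ (b ∈ u ∧ a ∉ u) →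
      TubeCompatible G (A ∪ t) u := by
    intro t ht u hu hBt hBu
    by_cases hau : a ∈ u
    · by_cases hbu : b ∈ u
      · refine Or.inl (Set.union_subset ?_ ?_)
        · rcases hA with rfl | ⟨hAT, haA, hbA⟩
          · exact Set.empty_subset _
          · rcases hnest A hAT u hu with h | h | h
            · exact h
            · exact absurd (h hbu) hbA
            · exact absurd hau (h.1 a haA)
        · rcases hnest t ht u hu with h | h | h
          · exact h
          · exact absurd (h hau) hBt.2
          · exact absurd hbu (h.1 b hBt.1)
      · exact Or.inr (Or.inl ((hmax u hu hau hbu).trans Set.subset_union_left))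
    · have hbu : b ∉ u := fun hbu => hBu ⟨hbu, hau⟩
      have hAu : u ⊆ A ∨ (∀ x ∈ A, x ∉ u) ∧ ∀ x ∈ A, ∀ y ∈ u, ¬ H.Adj x y := by
        rcases hA with rfl | ⟨hAT, haA, hbA⟩
        · simp
        · exact (hnest A hAT u hu).resolve_left fun h => hau (h haA)
      have htu := (hnest t ht u hu).resolve_left fun h => hbu (h hBt.1)
      rcases hAu with h | hAu
      · exact Or.inr (Or.inl (h.trans Set.subset_union_left))
      rcases htu with h | htu
      · exact Or.inr (Or.inl (h.trans Set.subset_union_right))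
      refine Or.inr (Or.inr (not_isTube_union ⟨b, Or.inr hBt.1⟩ (htube u hu).1 ?_ ?_))
      · rintro x (hx | hx)
        · exact hAu.1 x hx
        · exact htu.1 x hx
      · intro x hx y hy hxy
        have hn : ¬ H.Adj x y := hx.elim (fun hx => hAu.2 x hx y hy) (fun hx => htu.2 x hx y hy)
        rcases hadj x y hxy hn with ⟨-, rfl⟩ | ⟨-, rfl⟩
        · exact hbu hy
        · exact hau hy
  refine ⟨enlarge a b A '' T, isTubing_of_theta hle hT ?_ ?_ hTheta, hTheta⟩
  · rintro _ ⟨t, ht, rfl⟩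
    by_cases hB : b ∈ t ∧ a ∉ t
    · rw [enlarge_of_mem hB]
      rcases hA with rfl | ⟨hAT, haA, hbA⟩
      · rw [Set.empty_union]
        exact (htube t ht).mono hle
      · exact ((htube A hAT).mono hle).union ((htube t ht).mono hle) haA hB.1 (Or.inr hab)
    · rw [enlarge_of_not hB]
      exact (htube t ht).mono hle
  · rintro _ ⟨t, ht, rfl⟩ _ ⟨u, hu, rfl⟩
    by_cases hBt : b ∈ t ∧ a ∉ t <;> by_cases hBu : b ∈ u ∧ a ∉ u
    · rw [enlarge_of_mem hBt, enlarge_of_mem hBu]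
      rcases hnest t ht u hu with h | h | h
      · exact Or.inl (Set.union_subset_union_right A h)
      · exact Or.inr (Or.inl (Set.union_subset_union_right A h))
      · exact absurd hBu.1 (h.1 b hBt.1)
    · rw [enlarge_of_mem hBt, enlarge_of_not hBu]
      exact hmixed t ht u hu hBt hBu
    · rw [enlarge_of_not hBt, enlarge_of_mem hBu]
      exact (hmixed u hu t ht hBu hBt).symm
    · rw [enlarge_of_not hBt, enlarge_of_not hBu]
      refine (hnest t ht u hu).imp_right (Or.imp_right fun h => ?_)
      refine not_isTube_union (htube t ht).1 (htube u hu).1 h.1 fun x hx y hy hxy => ?_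
      rcases hadj x y hxy (h.2 x hx y hy) with ⟨rfl, rfl⟩ | ⟨rfl, rfl⟩
      · exact h.1 x hx (by_contra fun hxu => hBu ⟨hy, hxu⟩)
      · exact h.1 y (by_contra fun hyt => hBt ⟨hx, hyt⟩) hy
end

section
/- The product of ΔSym is associative: for all p, q, r ≥ 1, 1 ≤ j ≤ p, 1 ≤ l ≤ q, 1 ≤ m ≤ r, one has (e^p_j · e^q_l) · e^r_m = e^p_j · (e^q_l · e^r_m) in the degree p+q+r component; hence ΔSym is an associative graded algebra. -/
/-- The index set for the basis of `ΔSym`: the basis vector `e^n_j` of the degree-`n`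
component `ℚ^n` is indexed by `⟨n, j⟩` with `j : Fin n` (encoding `j+1 ∈ {1,…,n}`). -/
abbrev DIndex : Type := Σ n : ℕ, Fin n

/-- The graded vector space `ΔSym` (without its degree-0 unit adjoined). -/
abbrev DSpace : Type := DIndex →₀ ℚ

/-- The product of basis vectors: `e^p_j · e^q_l` is the sum over all `p`-element subsets
`S ⊆ {1,…,p+q}` of `e^{p+q}_{ι̂_S(l)}`, where `ι̂_S : {1,…,q} → {1,…,p+q} ∖ S` is the
order-preserving bijection. -/
noncomputable def dBasisMul (x y : DIndex) : DSpace :=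
  ∑ S ∈ (Finset.univ.filter fun S : Finset (Fin (x.1 + y.1)) => S.card = x.1).attach,
    Finsupp.single
      ⟨x.1 + y.1,
        ↑((S.1ᶜ).orderIsoOfFin
          (by have h := (Finset.mem_filter.mp S.2).2
              simp [Finset.card_compl, h]) y.2)⟩ (1 : ℚ)

/-- The bilinear extension of the basis product to all of `DSpace`. -/
noncomputable def dMul (a b : DSpace) : DSpace :=
  a.sum fun x ca => b.sum fun y cb => (ca * cb) • dBasisMul x y

/-- The basis vector `e^n_k`, where `k` is the `m`-th element of the `r`-element set `R`;
zero if `R` does not have `r` elements. -/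
noncomputable def nthBasis {n r : ℕ} (m : Fin r) (R : Finset (Fin n)) : DSpace :=
  if h : R.card = r then Finsupp.single ⟨n, R.orderEmbOfFin h m⟩ 1 else 0

theorem nthBasis_of_card {n r : ℕ} (m : Fin r) {R : Finset (Fin n)} (h : R.card = r) :
    nthBasis m R = Finsupp.single ⟨n, R.orderEmbOfFin h m⟩ 1 :=
  dif_pos h

theorem dBasisMul_eq_sum_compl {p q : ℕ} (j : Fin p) (l : Fin q) :
    dBasisMul ⟨p, j⟩ ⟨q, l⟩ =
      ∑ S ∈ Finset.powersetCard p (Finset.univ : Finset (Fin (p + q))), nthBasis l Sᶜ := by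
  have hs : Finset.powersetCard p (Finset.univ : Finset (Fin (p + q))) =
      Finset.univ.filter fun S : Finset (Fin (p + q)) => S.card = p := by
    ext S
    simp [Finset.mem_powersetCard]
  rw [hs, ← Finset.sum_attach]
  refine Finset.sum_congr rfl fun S _ => ?_
  have h := (Finset.mem_filter.mp S.2).2
  rw [nthBasis_of_card l (by simp [Finset.card_compl, h])]
  simp only [Finset.coe_orderIsoOfFin_apply]

theorem dBasisMul_eq_sum {p q n : ℕ} (hn : p + q = n) (j : Fin p) (l : Fin q) :
    dBasisMul ⟨p, j⟩ ⟨q, l⟩ =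
      ∑ R ∈ Finset.powersetCard q (Finset.univ : Finset (Fin n)), nthBasis l R := by
  subst hn
  rw [dBasisMul_eq_sum_compl]
  refine Finset.sum_nbij' compl compl ?_ ?_ ?_ ?_ ?_ <;>
    simp +contextual [Finset.mem_powersetCard, Finset.card_compl]

theorem dMul_single_single (x y : DIndex) :
    dMul (Finsupp.single x 1) (Finsupp.single y 1) = dBasisMul x y := by
  simp [dMul]

theorem dMul_sum_left {ι : Type*} (s : Finset ι) (f : ι → DSpace) (b : DSpace) :
    dMul (∑ i ∈ s, f i) b = ∑ i ∈ s, dMul (f i) b := by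
  unfold dMul
  refine (Finsupp.sum_finsetSum_index ?_ ?_).symm
  · simp
  · intro x c d
    simp [add_mul, add_smul, Finsupp.sum_add]

theorem dMul_sum_right {ι : Type*} (s : Finset ι) (a : DSpace) (f : ι → DSpace) :
    dMul a (∑ i ∈ s, f i) = ∑ i ∈ s, dMul a (f i) := by
  unfold dMul
  rw [← Finsupp.sum_finsetSum_comm]
  refine Finsupp.sum_congr fun x _ => (Finsupp.sum_finsetSum_index ?_ ?_).symm
  · simp
  · intro y c d
    simp [mul_add, add_smul]

/-- Taking the element of `W` whose position is the `m`-th element of `U` amounts to taking the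
`m`-th element of the corresponding subset of `W`. -/
theorem sum_nthBasis_orderEmbOfFin {n k r : ℕ} (m : Fin r) {W : Finset (Fin n)}
    (hW : W.card = k) (f : Finset (Fin k) → DSpace)
    (hf : ∀ U (hU : U.card = r), f U = nthBasis (U.orderEmbOfFin hU m) W) :
    ∑ U ∈ Finset.powersetCard r Finset.univ, f U =
      ∑ R ∈ Finset.powersetCard r W, nthBasis m R := by
  have hWmap : Finset.powersetCard r W =
      Finset.powersetCard r (Finset.univ.map (W.orderEmbOfFin hW).toEmbedding) := by simp
  rw [hWmap, Finset.powersetCard_map, Finset.sum_map]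
  refine Finset.sum_congr rfl fun U hU => ?_
  have hU' := (Finset.mem_powersetCard.mp hU).2
  have hc : (U.map (W.orderEmbOfFin hW).toEmbedding).card = r := by simpa using hU'
  rw [hf U hU', nthBasis_of_card _ hW]
  refine Eq.trans ?_ (nthBasis_of_card m hc).symm
  have := Finset.orderEmbOfFin_unique' hc
    (f := (U.orderEmbOfFin hU').trans (W.orderEmbOfFin hW)) (by intro i; simp)
  rw [← this]
  rfl

/-- Each `r`-subset is disjoint from exactly `(n - r).choose p` of the `p`-subsets. -/
theorem sum_powersetCard_compl {n p r : ℕ} {M : Type*} [AddCommMonoid M]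
    (g : Finset (Fin n) → M) :
    ∑ S ∈ Finset.powersetCard p Finset.univ, ∑ R ∈ Finset.powersetCard r Sᶜ, g R =
      ∑ R ∈ Finset.powersetCard r Finset.univ, (n - r).choose p • g R := by
  rw [Finset.sum_comm' (t' := Finset.powersetCard r Finset.univ)
    (s' := fun R => Finset.powersetCard p Rᶜ)]
  · refine Finset.sum_congr rfl fun R hR => ?_
    rw [Finset.sum_const, Finset.card_powersetCard, Finset.card_compl,
      (Finset.mem_powersetCard.mp hR).2, Fintype.card_fin]
  · intro S R
    simp only [Finset.mem_powersetCard, Finset.subset_univ, true_and,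
      Finset.subset_compl_comm (s := R)]
    tauto

/-- The product of `ΔSym` is associative on basis vectors (hence `ΔSym`
is an associative graded algebra). -/
theorem dMul_assoc (p q r : ℕ) (hp : 1 ≤ p) (hq : 1 ≤ q) (hr : 1 ≤ r)
    (j : Fin p) (l : Fin q) (m : Fin r) :
    dMul (dMul (Finsupp.single ⟨p, j⟩ 1) (Finsupp.single ⟨q, l⟩ 1))
        (Finsupp.single ⟨r, m⟩ 1) =
      dMul (Finsupp.single ⟨p, j⟩ 1)
        (dMul (Finsupp.single ⟨q, l⟩ 1) (Finsupp.single ⟨r, m⟩ 1)) := by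
  have hleft : ∀ R ∈ Finset.powersetCard q (Finset.univ : Finset (Fin (p + q))),
      dMul (nthBasis l R) (Finsupp.single ⟨r, m⟩ 1) =
        ∑ T ∈ Finset.powersetCard r (Finset.univ : Finset (Fin (p + (q + r)))),
          nthBasis m T := by
    intro R hR
    rw [nthBasis_of_card l (Finset.mem_powersetCard.mp hR).2, dMul_single_single,
      dBasisMul_eq_sum (add_assoc p q r)]
  have hright : ∀ U ∈ Finset.powersetCard r (Finset.univ : Finset (Fin (q + r))),
      dMul (Finsupp.single ⟨p, j⟩ 1) (nthBasis m U) =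
        ∑ S ∈ Finset.powersetCard p (Finset.univ : Finset (Fin (p + (q + r)))),
          if hU : U.card = r then nthBasis (U.orderEmbOfFin hU m) Sᶜ else 0 := by
    intro U hU
    have hU' := (Finset.mem_powersetCard.mp hU).2
    rw [nthBasis_of_card m hU', dMul_single_single, dBasisMul_eq_sum_compl]
    simp only [dif_pos hU']
  rw [dMul_single_single, dMul_single_single, dBasisMul_eq_sum rfl, dBasisMul_eq_sum rfl,
    dMul_sum_left, dMul_sum_right, Finset.sum_congr rfl hleft, Finset.sum_congr rfl hright,
    Finset.sum_const, Finset.sum_comm]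
  have hinner : ∀ S ∈ Finset.powersetCard p (Finset.univ : Finset (Fin (p + (q + r)))),
      (∑ U ∈ Finset.powersetCard r (Finset.univ : Finset (Fin (q + r))),
        if hU : U.card = r then nthBasis (U.orderEmbOfFin hU m) Sᶜ else 0) =
      ∑ R ∈ Finset.powersetCard r Sᶜ, nthBasis m R := by
    intro S hS
    refine sum_nthBasis_orderEmbOfFin m ?_ _ fun U hU => dif_pos hU
    simp [Finset.card_compl, (Finset.mem_powersetCard.mp hS).2]
  rw [Finset.sum_congr rfl hinner, sum_powersetCard_compl,
    Finset.card_powersetCard, Finset.card_univ, Fintype.card_fin, ← Finset.smul_sum,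
    ← Nat.choose_symm_add, ← add_assoc, Nat.add_sub_cancel]
end
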